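/- Let n ≥ 3 and α > γ₀. Then W(r, α) − c_* = O(r^{−n}) as r → ∞, the integral μ(α) := ∫₁^∞ s (W(s, α) − c_*) ds converges absolutely, and the function φ(r) := b + ∫₁^r s W(s, α) ds satisfies φ(r) = (c_*/2) r² + μ(α) + b − c_*/2 + O(r^{2−n}) as r → ∞. -/

import Mathlib

open Set Filter MeasureTheory Asymptotics

/-- The vector `(β, γ, …, γ) ∈ ℝⁿ`: first coordinate `β`, all remaining coordinates `γ`. -/
def vec (n : ℕ) (β γ : ℝ) : Fin n → ℝ := fun j => if (j : ℕ) = 0 then β else γ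

/-- `w` is a `C¹` solution on `[1, ∞)` of the ODE `dW/dr = (g(W) - W)/r` with `w 1 = a`,
taking values in `(γ₀, ∞)`. -/
def IsSolW (g : ℝ → ℝ) (γ₀ a : ℝ) (w : ℝ → ℝ) : Prop :=
  ContDiffOn ℝ 1 w (Set.Ici 1) ∧ w 1 = a ∧ (∀ r ∈ Set.Ici (1 : ℝ), γ₀ < w r) ∧
    ∀ r ∈ Set.Ici (1 : ℝ), HasDerivWithinAt w ((g (w r) - w r) / r) (Set.Ici 1) r

lemma ConcaveOn.le_add_fderiv {E : Type*} [NormedAddCommGroup E] [NormedSpace ℝ E]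
    {s : Set E} {f : E → ℝ} (hf : ConcaveOn ℝ s f) {x y : E} (hx : x ∈ s) (hy : y ∈ s)
    (hd : DifferentiableAt ℝ f y) : f x ≤ f y + fderiv ℝ f y (x - y) := by
  have hconc := hf.comp_affineMap (AffineMap.lineMap (k := ℝ) y x)
  have hderiv : HasDerivAt (f ∘ AffineMap.lineMap (k := ℝ) y x) (fderiv ℝ f y (x - y)) 0 := by
    apply HasFDerivAt.comp_hasDerivAt
    · simpa using hd.hasFDerivAt
    · exact AffineMap.hasDerivAt_lineMap
  have h := hconc.slope_le_of_hasDerivAt (x := 0) (y := 1) (by simpa using hy) (by simpa using hx)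
    one_pos hderiv
  simp [slope_def_field] at h
  rw [map_sub]
  linarith

lemma clm_apply_eq_sum_mul_single {n : ℕ} (L : (Fin n → ℝ) →L[ℝ] ℝ) (v : Fin n → ℝ) :
    L v = ∑ j, v j * L (Pi.single j 1) := by
  have h := LinearMap.pi_apply_eq_sum_univ (L : (Fin n → ℝ) →ₗ[ℝ] ℝ) v
  simp only [ContinuousLinearMap.coe_coe, smul_eq_mul] at h
  rw [h]
  refine Finset.sum_congr rfl fun j _ => ?_
  congr 2
  ext i
  simp [Pi.single_apply, eq_comm]

lemma fderiv_single_eq_of_symmetric {n : ℕ} {f : (Fin n → ℝ) → ℝ}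
    (hf : ∀ σ : Equiv.Perm (Fin n), ∀ x : Fin n → ℝ, f (x ∘ σ) = f x) (c : ℝ)
    (hd : DifferentiableAt ℝ f fun _ => c) (i j : Fin n) :
    fderiv ℝ f (fun _ => c) (Pi.single i 1) = fderiv ℝ f (fun _ => c) (Pi.single j 1) := by
  let P : (Fin n → ℝ) →L[ℝ] (Fin n → ℝ) :=
    ContinuousLinearMap.pi fun k => ContinuousLinearMap.proj (Equiv.swap i j k)
  have hP : ∀ x, P x = x ∘ Equiv.swap i j := fun x => rfl
  have hPc : P (fun _ => c) = fun _ => c := rfl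
  have hcomp : HasFDerivAt (f ∘ P) ((fderiv ℝ f fun _ => c).comp P) (fun _ => c) := by
    apply HasFDerivAt.comp
    · rw [hPc]; exact hd.hasFDerivAt
    · exact P.hasFDerivAt
  have hfP : f ∘ P = f := by ext x; simp [hP, hf]
  rw [hfP] at hcomp
  have h := congrArg (fun L => L (Pi.single i 1)) hcomp.fderiv
  simp only [ContinuousLinearMap.comp_apply, hP] at h
  rw [h]
  congr 1
  ext k
  simp only [Function.comp_apply, Pi.single_apply, Equiv.swap_apply_eq_iff, Equiv.swap_apply_left]

lemma ConcaveOn.lt_of_le_of_fderiv_pos {n : ℕ} {s : Set (Fin n → ℝ)} {f : (Fin n → ℝ) → ℝ}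
    (hf : ConcaveOn ℝ s f) (hd : ∀ x ∈ s, DifferentiableAt ℝ f x)
    (hpos : ∀ x ∈ s, ∀ j, 0 < fderiv ℝ f x (Pi.single j 1)) {x y : Fin n → ℝ}
    (hx : x ∈ s) (hy : y ∈ s) (hxy : x < y) : f x < f y := by
  have h := hf.le_add_fderiv hx hy (hd y hy)
  rw [clm_apply_eq_sum_mul_single] at h
  obtain ⟨hle, i, hi⟩ := Pi.lt_def.1 hxy
  have hneg : ∑ j, (x - y) j * fderiv ℝ f y (Pi.single j 1) < 0 := by
    refine Finset.sum_neg' (fun j _ => ?_) ⟨i, Finset.mem_univ i, ?_⟩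
    · exact mul_nonpos_of_nonpos_of_nonneg (sub_nonpos.2 (hle j)) (hpos y hy j).le
    · exact mul_neg_of_neg_of_pos (sub_neg.2 hi) (hpos y hy i)
  linarith

lemma antitoneOn_Ici_of_hasDerivWithinAt {u u' : ℝ → ℝ} {a : ℝ}
    (h : ∀ r ∈ Ici a, HasDerivWithinAt u (u' r) (Ici a) r) (h0 : ∀ r ∈ Ici a, u' r ≤ 0) :
    AntitoneOn u (Ici a) :=
  antitoneOn_of_hasDerivWithinAt_nonpos (convex_Ici a) (fun r hr => (h r hr).continuousWithinAt)
    (fun r hr => (h r (interior_subset hr)).mono interior_subset)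
    (fun r hr => h0 r (interior_subset hr))

lemma hasDerivWithinAt_pow_mul {v : ℝ → ℝ} {k r : ℝ} {s : Set ℝ} {n : ℕ} (hn : n ≠ 0)
    (hr : r ≠ 0) (h : HasDerivWithinAt v (k / r) s r) :
    HasDerivWithinAt (fun r => r ^ n * v r) (r ^ (n - 1) * (n * v r + k)) s r := by
  convert! ((hasDerivAt_pow n r).hasDerivWithinAt (s := s)).mul h using 1
  obtain ⟨m, rfl⟩ := Nat.exists_eq_succ_of_ne_zero hn
  simp only [Nat.succ_eq_add_one, Nat.add_sub_cancel]
  field_simp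
  ring

/-- Decay of solutions of `r v' = k`, where `k` compares with `-n v` up to a quadratic error. -/
lemma exists_abs_mul_pow_le {v k : ℝ → ℝ} {n : ℕ} (hn : n ≠ 0) {C δ : ℝ} (hC : 0 ≤ C) (hδ : 0 < δ)
    (hv : ∀ r ∈ Ici (1 : ℝ), HasDerivWithinAt v (k r / r) (Ici 1) r)
    (hlow : ∀ r ∈ Ici (1 : ℝ), -n * v r ≤ k r)
    (hdecay : ∀ r ∈ Ici (1 : ℝ), 0 ≤ v r → k r ≤ -v r)
    (hquad : ∀ r ∈ Ici (1 : ℝ), 0 ≤ v r → v r ≤ δ → k r ≤ -n * v r + C * v r ^ 2) :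
    ∃ B R : ℝ, 1 ≤ R ∧ ∀ r, R ≤ r → |v r| * r ^ n ≤ B := by
  have hmono : AntitoneOn (fun r => -(r ^ n * v r)) (Ici 1) := by
    refine antitoneOn_Ici_of_hasDerivWithinAt
      (fun r hr => (hasDerivWithinAt_pow_mul hn (by linarith [mem_Ici.1 hr]) (hv r hr)).neg) ?_
    intro r hr
    have hr0 : (0 : ℝ) ≤ r := by linarith [mem_Ici.1 hr]
    have := mul_nonneg (pow_nonneg hr0 (n - 1))
      (show (0 : ℝ) ≤ n * v r + k r by linarith [hlow r hr])
    linarith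
  by_cases hneg : ∀ r ∈ Ici (1 : ℝ), v r < 0
  · refine ⟨-v 1, 1, le_rfl, fun r hr => ?_⟩
    have := hmono (mem_Ici.2 le_rfl) (mem_Ici.2 hr) hr
    rw [abs_of_neg (hneg r hr)]
    simp only [one_pow, one_mul] at this
    linarith
  push Not at hneg
  obtain ⟨a, ha, hva⟩ := hneg
  have ha' : (1 : ℝ) ≤ a := ha
  have hnonneg : ∀ r, a ≤ r → 0 ≤ v r := by
    intro r hr
    have h := hmono ha (mem_Ici.2 (ha'.trans hr)) hr
    have h1 : 0 ≤ a ^ n * v a := mul_nonneg (pow_nonneg (by linarith) n) hva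
    have h2 : (0 : ℝ) < r ^ n := pow_pos (by linarith) n
    exact nonneg_of_mul_nonneg_right (a := r ^ n) (by simp only at h; linarith) h2
  set M := a * v a
  have hM0 : 0 ≤ M := mul_nonneg (by linarith) hva
  have hfirst : ∀ r, a ≤ r → r * v r ≤ M := by
    have hanti : AntitoneOn (fun r => r ^ 1 * v r) (Ici a) := by
      refine antitoneOn_Ici_of_hasDerivWithinAt
        (fun r hr => hasDerivWithinAt_pow_mul one_ne_zero (by linarith [mem_Ici.1 hr])
          ((hv r (ha'.trans hr)).mono (Ici_subset_Ici.2 ha'))) ?_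
      intro r hr
      have := hdecay r (ha'.trans hr) (hnonneg r hr)
      simp only [Nat.sub_self, pow_zero, Nat.cast_one]
      linarith
    intro r hr
    simpa using hanti (mem_Ici.2 le_rfl) (mem_Ici.2 hr) hr
  set R := max a (M / δ)
  have haR : a ≤ R := le_max_left _ _
  have hsmall : ∀ r, R ≤ r → v r ≤ δ := by
    intro r hr
    have h1 : M / δ ≤ r := (le_max_right _ _).trans hr
    have h2 := hfirst r (haR.trans hr)
    rw [div_le_iff₀ hδ] at h1
    exact le_of_mul_le_mul_left (h2.trans h1) (by linarith)
  have hz : AntitoneOn (fun r => r ^ n * v r * Real.exp (C * M * r⁻¹)) (Ici R) := by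
    refine antitoneOn_Ici_of_hasDerivWithinAt (u' := fun r =>
      r ^ (n - 1) * (n * v r + k r) * Real.exp (C * M * r⁻¹) +
      r ^ n * v r * (Real.exp (C * M * r⁻¹) * (C * M * (-(r ^ 2)⁻¹)))) ?_ ?_
    · intro r hr
      have hr0 : r ≠ 0 := by linarith [mem_Ici.1 hr]
      have h1 : (1 : ℝ) ≤ R := ha'.trans haR
      exact (hasDerivWithinAt_pow_mul hn hr0
        ((hv r (h1.trans hr)).mono (Ici_subset_Ici.2 h1))).mul
        (((hasDerivAt_inv hr0).const_mul (C * M)).exp.hasDerivWithinAt)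
    · intro r hr
      have hr1 : (1 : ℝ) ≤ r := (ha'.trans haR).trans hr
      have hr0 : 0 < r := by linarith
      have har : a ≤ r := haR.trans hr
      have hv0 := hnonneg r har
      have h1 := hquad r hr1 hv0 (hsmall r hr)
      have h2 := hfirst r har
      have hpow : r ^ n = r ^ (n - 1) * r := by
        rw [← pow_succ, Nat.sub_add_cancel (Nat.one_le_iff_ne_zero.2 hn)]
      have heq : r ^ (n - 1) * (n * v r + k r) * Real.exp (C * M * r⁻¹) +
          r ^ n * v r * (Real.exp (C * M * r⁻¹) * (C * M * (-(r ^ 2)⁻¹))) =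
          r ^ (n - 1) * Real.exp (C * M * r⁻¹) * ((n * v r + k r) - C * v r * (M / r)) := by
        rw [hpow]
        field_simp
        ring
      rw [heq]
      refine mul_nonpos_of_nonneg_of_nonpos (by positivity) ?_
      have h3 : v r ≤ M / r := by rw [le_div_iff₀ hr0]; linarith
      have h4 := mul_le_mul_of_nonneg_left h3 (mul_nonneg hC hv0)
      nlinarith
  refine ⟨R ^ n * v R * Real.exp (C * M * R⁻¹), R, ha'.trans haR, fun r hr => ?_⟩
  have h1 := hz (mem_Ici.2 le_rfl) (mem_Ici.2 hr) hr
  have hr0 : 0 < r := by linarith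
  have hv0 := hnonneg r (haR.trans hr)
  rw [abs_of_nonneg hv0]
  have h2 : (1 : ℝ) ≤ Real.exp (C * M * r⁻¹) := Real.one_le_exp (by positivity)
  have h3 : 0 ≤ r ^ n * v r := by positivity
  simp only at h1
  nlinarith [le_mul_of_one_le_right h3 h2]

/-- Expansion of a primitive of `s * w s` when `w - c` decays like `r ^ (-n)`. -/
lemma integral_expansion_of_isBigO {n : ℕ} (hn : 3 ≤ n) {w : ℝ → ℝ} {c : ℝ} (b : ℝ)
    (hw : ContinuousOn w (Ici 1))
    (hO : (fun r : ℝ => w r - c) =O[atTop] (fun r : ℝ => r ^ (-(n : ℝ)))) :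
    IntegrableOn (fun s : ℝ => s * (w s - c)) (Set.Ioi 1) ∧
    (fun r : ℝ => (b + ∫ s in (1 : ℝ)..r, s * w s) -
        (c / 2 * r ^ 2 + (∫ s in Set.Ioi (1 : ℝ), s * (w s - c)) + b - c / 2))
      =O[atTop] (fun r : ℝ => r ^ ((2 : ℝ) - n)) := by
  have hn' : (3 : ℝ) ≤ n := by exact_mod_cast hn
  have hcont : ContinuousOn (fun s : ℝ => s * (w s - c)) (Ici 1) := by fun_prop
  have hO' : (fun s : ℝ => s * (w s - c)) =O[atTop] (fun s : ℝ => s ^ (1 - (n : ℝ))) := by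
    refine ((isBigO_refl (fun s : ℝ => s) atTop).mul hO).congr' EventuallyEq.rfl ?_
    filter_upwards [eventually_gt_atTop 0] with s hs
    rw [sub_eq_add_neg, Real.rpow_add hs, Real.rpow_one]
  have hlt : 1 - (n : ℝ) < -1 := by linarith
  have hint : IntegrableOn (fun s : ℝ => s * (w s - c)) (Ioi 1) := by
    refine IntegrableOn.mono_set ?_ Ioi_subset_Ici_self
    exact (hcont.locallyIntegrableOn measurableSet_Ici).integrableOn_of_isBigO_atTop hO'
      (integrableAtFilter_rpow_atTop_iff.2 hlt)
  refine ⟨hint, ?_⟩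
  obtain ⟨K, hK⟩ := hO'.bound
  obtain ⟨A, hA⟩ := eventually_atTop.1 hK
  refine IsBigO.of_bound (K / (n - 2)) ?_
  filter_upwards [eventually_ge_atTop A, eventually_ge_atTop 1] with r hrA hr1
  have hr0 : 0 < r := by linarith
  have hsub : Icc 1 r ⊆ Ici (1 : ℝ) := Icc_subset_Ici_self
  have hi1 : IntervalIntegrable (fun s : ℝ => s * (w s - c)) volume 1 r :=
    (hcont.mono hsub).intervalIntegrable_of_Icc hr1
  have hsplit : ∫ s in (1 : ℝ)..r, s * w s =
      (∫ s in (1 : ℝ)..r, s * (w s - c)) + c * ((r ^ 2 - 1) / 2) := by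
    have hid : ∫ s in (1 : ℝ)..r, c * s = c * ((r ^ 2 - 1) / 2) := by
      rw [intervalIntegral.integral_const_mul, integral_id]; norm_num
    rw [← hid, ← intervalIntegral.integral_add hi1 (Continuous.intervalIntegrable (by fun_prop) _ _)]
    congr 1
    ext s
    ring
  have htail := intervalIntegral.integral_interval_add_Ioi hint
    (hint.mono_set (Ioi_subset_Ioi hr1))
  have heq : (b + ∫ s in (1 : ℝ)..r, s * w s) -
      (c / 2 * r ^ 2 + (∫ s in Set.Ioi (1 : ℝ), s * (w s - c)) + b - c / 2) =
      -∫ s in Ioi r, s * (w s - c) := by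
    rw [hsplit, ← htail]; ring
  rw [heq, norm_neg]
  have hbound : ‖∫ s in Ioi r, s * (w s - c)‖ ≤ ∫ s in Ioi r, K * s ^ (1 - (n : ℝ)) := by
    refine norm_integral_le_of_norm_le ((integrableOn_Ioi_rpow_of_lt hlt hr0).const_mul K) ?_
    refine (ae_restrict_iff' measurableSet_Ioi).2 (Eventually.of_forall fun s hs => ?_)
    have hs0 : 0 < s := hr0.trans hs
    have := hA s (hrA.trans (le_of_lt hs))
    rwa [Real.norm_of_nonneg (Real.rpow_nonneg hs0.le (1 - (n : ℝ)))] at this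
  refine hbound.trans (le_of_eq ?_)
  rw [integral_const_mul, integral_Ioi_rpow_of_lt hlt hr0,
    Real.norm_of_nonneg (Real.rpow_nonneg hr0.le _),
    show 1 - (n : ℝ) + 1 = 2 - n by ring]
  have h2 : (n : ℝ) - 2 ≠ 0 := by linarith
  have h2' : (2 : ℝ) - n ≠ 0 := by linarith
  field_simp
  ring

lemma sum_vec {n : ℕ} (hn : 1 ≤ n) (β γ : ℝ) : ∑ j, vec n β γ j = β + (n - 1) * γ := by
  obtain ⟨m, rfl⟩ := Nat.exists_eq_add_of_le' hn
  simp [Fin.sum_univ_succ, vec]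

/-- For `n ≥ 3` and `α > γ₀`: `W(r, α) − c_* = O(r^{−n})` as `r → ∞`, the integral
`μ(α) = ∫₁^∞ s (W(s, α) − c_*) ds` converges absolutely, and
`φ(r) = b + ∫₁^r s W(s, α) ds` satisfies
`φ(r) = (c_*/2) r² + μ(α) + b − c_*/2 + O(r^{2−n})` as `r → ∞`. -/
theorem stmt15 (n : ℕ) (hn : 3 ≤ n)
    (Γ : Set (Fin n → ℝ))
    (hΓopen : IsOpen Γ)
    (hΓconv : Convex ℝ Γ)
    (hΓcone : ∀ x ∈ Γ, ∀ t : ℝ, 0 < t → t • x ∈ Γ)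
    (hΓsym : ∀ σ : Equiv.Perm (Fin n), ∀ x ∈ Γ, (x ∘ σ) ∈ Γ)
    (hΓ1 : {x : Fin n → ℝ | ∀ j, 0 < x j} ⊆ Γ)
    (hΓ2 : Γ ⊆ {x : Fin n → ℝ | 0 < ∑ j, x j})
    (f : (Fin n → ℝ) → ℝ)
    (hfsmooth : ContDiffOn ℝ (⊤ : ℕ∞) f Γ)
    (hfcont : ContinuousOn f (closure Γ))
    (hfsym : ∀ σ : Equiv.Perm (Fin n), ∀ x : Fin n → ℝ, f (x ∘ σ) = f x)
    (hfconc : ConcaveOn ℝ Γ f)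
    (hfpos : ∀ x ∈ Γ, 0 < f x)
    (hfbd : ∀ x ∈ frontier Γ, f x = 0)
    (hfmono : ∀ x ∈ Γ, ∀ j : Fin n, 0 < fderiv ℝ f x (Pi.single j 1))
    (cstar : ℝ) (hcstar : 0 < cstar)
    (hfcstar : f (fun _ => cstar) = 1)
    (γ₀ : ℝ)
    (hγ₀ : γ₀ = sInf {γ : ℝ | 0 < γ ∧ ∃ β : ℝ, vec n β γ ∈ Γ ∧ f (vec n β γ) = 1})
    (hγ₀0 : 0 ≤ γ₀) (hγ₀cstar : γ₀ < cstar)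
    (g : ℝ → ℝ)
    (hg : ∀ γ ∈ Set.Ioi γ₀, vec n (g γ) γ ∈ Γ ∧ f (vec n (g γ) γ) = 1)
    (hgu : ∀ γ ∈ Set.Ioi γ₀, ∀ β : ℝ, vec n β γ ∈ Γ → f (vec n β γ) = 1 → β = g γ)
    (b : ℝ) (α : ℝ) (hα : γ₀ < α) (w : ℝ → ℝ) (hw : IsSolW g γ₀ α w) :
    (fun r : ℝ => w r - cstar) =O[atTop] (fun r : ℝ => r ^ (-(n : ℝ))) ∧
    IntegrableOn (fun s : ℝ => s * (w s - cstar)) (Set.Ioi 1) ∧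
    (fun r : ℝ => (b + ∫ s in (1 : ℝ)..r, s * w s) -
        (cstar / 2 * r ^ 2 + (∫ s in Set.Ioi (1 : ℝ), s * (w s - cstar)) + b - cstar / 2))
      =O[atTop] (fun r : ℝ => r ^ ((2 : ℝ) - n)) := by
  have hn1 : 1 ≤ n := by omega
  have hn0 : n ≠ 0 := by omega
  have hn' : (3 : ℝ) ≤ n := by exact_mod_cast hn
  have hdiff : ∀ x ∈ Γ, DifferentiableAt ℝ f x := fun x hx =>
    (hfsmooth.contDiffAt (hΓopen.mem_nhds hx)).differentiableAt (by simp)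
  set e : Fin n → ℝ := fun _ => cstar with he
  have heΓ : e ∈ Γ := hΓ1 fun _ => hcstar
  let i₀ : Fin n := ⟨0, by omega⟩
  set p := fderiv ℝ f e (Pi.single i₀ 1) with hp
  have hp0 : 0 < p := hfmono e heΓ i₀
  have hL : ∀ β γ : ℝ, fderiv ℝ f e (vec n β γ - e) =
      p * ((β - cstar) + (n - 1) * (γ - cstar)) := by
    intro β γ
    rw [clm_apply_eq_sum_mul_single,
      Finset.sum_congr rfl fun j _ => by
        rw [fderiv_single_eq_of_symmetric hfsym cstar (hdiff e heΓ) j i₀],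
      ← Finset.sum_mul]
    simp only [Pi.sub_apply, Finset.sum_sub_distrib, sum_vec hn1, he]
    simp only [Finset.sum_const, Finset.card_univ, Fintype.card_fin, nsmul_eq_mul]
    ring
  have hglow : ∀ γ, γ₀ < γ → -n * (γ - cstar) ≤ g γ - γ := by
    intro γ hγ
    obtain ⟨hmem, h1⟩ := hg γ hγ
    have h := hfconc.le_add_fderiv hmem heΓ (hdiff e heΓ)
    rw [h1, hfcstar, hL] at h
    have := nonneg_of_mul_nonneg_right
      (show 0 ≤ p * (g γ - cstar + (n - 1) * (γ - cstar)) by linarith) hp0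
    linarith
  have hgup : ∀ γ, γ₀ < γ → ∀ β, vec n β γ ∈ Γ → 1 ≤ f (vec n β γ) → g γ ≤ β := by
    intro γ hγ β hmem hβ
    obtain ⟨hmem', h1⟩ := hg γ hγ
    by_contra! hlt
    have : f (vec n β γ) < f (vec n (g γ) γ) := by
      refine hfconc.lt_of_le_of_fderiv_pos hdiff hfmono hmem hmem' (Pi.lt_def.2 ⟨?_, i₀, ?_⟩)
      · intro j
        simp only [vec]
        split_ifs
        exacts [hlt.le, le_rfl]
      · simpa [vec, i₀] using hlt
    linarith
  have hgdecay : ∀ γ, cstar ≤ γ → g γ - γ ≤ -(γ - cstar) := by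
    intro γ hγ
    have hmem : vec n cstar γ ∈ Γ := hΓ1 fun j => by
      simp only [vec]
      split_ifs
      exacts [hcstar, hcstar.trans_le hγ]
    have hle : e ≤ vec n cstar γ := fun j => by
      simp only [vec, he]
      split_ifs
      exacts [le_rfl, hγ]
    have hf1 : 1 ≤ f (vec n cstar γ) := by
      rw [← hfcstar]
      rcases hle.eq_or_lt with h | h
      · rw [← h]
      · exact (hfconc.lt_of_le_of_fderiv_pos hdiff hfmono heΓ hmem h).le
    linarith [hgup γ (hγ₀cstar.trans_le hγ) cstar hmem hf1]
  obtain ⟨C, δ, hC, hδ, hquad⟩ : ∃ C δ : ℝ, 0 ≤ C ∧ 0 < δ ∧ ∀ γ, cstar ≤ γ → γ - cstar ≤ δ →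
      g γ - γ ≤ -n * (γ - cstar) + C * (γ - cstar) ^ 2 := by
    have hC2 : ContDiffAt ℝ 1 (fderiv ℝ f) e :=
      (hfsmooth.contDiffAt (hΓopen.mem_nhds heΓ)).fderiv_right (by norm_cast)
    obtain ⟨K, t, ht, hK⟩ := hC2.exists_lipschitzOnWith
    obtain ⟨ε, hε, hball⟩ := Metric.mem_nhds_iff.1 (inter_mem ht (hΓopen.mem_nhds heΓ))
    set C : ℝ := K * n ^ 2 / p with hCdef
    have hC : 0 ≤ C := by positivity
    refine ⟨C, min (1 / (C + 1)) (ε / (2 * n)), hC, by positivity, fun γ hγ hγδ => ?_⟩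
    set v := γ - cstar with hv
    have hv0 : 0 ≤ v := sub_nonneg.2 hγ
    have hCv : C * v ≤ 1 := by
      have h1 := hγδ.trans (min_le_left _ _)
      rw [le_div_iff₀ (by positivity)] at h1
      linarith
    have hvε : n * v < ε := by
      have h1 := hγδ.trans (min_le_right _ _)
      rw [le_div_iff₀ (by positivity)] at h1
      linarith
    set β := cstar - (n - 1) * v + C * v ^ 2 with hβ
    have hnorm : ‖vec n β γ - e‖ ≤ n * v := by
      refine (pi_norm_le_iff_of_nonneg (by positivity)).2 fun j => ?_
      rw [Real.norm_eq_abs, abs_le]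
      simp only [Pi.sub_apply, vec, he]
      split_ifs
      · constructor <;> nlinarith
      · constructor <;> nlinarith
    have hin := hball (show vec n β γ ∈ Metric.ball e ε by
      rw [Metric.mem_ball, dist_eq_norm]; linarith)
    have hine := hball (Metric.mem_ball_self hε)
    have hlip : ‖fderiv ℝ f (vec n β γ) - fderiv ℝ f e‖ ≤ K * (n * v) :=
      (hK.norm_sub_le hin.1 hine.1).trans (mul_le_mul_of_nonneg_left hnorm K.2)
    have htan := hfconc.le_add_fderiv heΓ hin.2 (hdiff _ hin.2)
    have hneg : fderiv ℝ f (vec n β γ) (e - vec n β γ) =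
        -((fderiv ℝ f (vec n β γ) - fderiv ℝ f e) (vec n β γ - e)) -
          fderiv ℝ f e (vec n β γ - e) := by
      rw [← neg_sub (vec n β γ) e, map_neg, _root_.sub_apply]
      ring
    have herr : |(fderiv ℝ f (vec n β γ) - fderiv ℝ f e) (vec n β γ - e)| ≤
        K * (n * v) * (n * v) :=
      (ContinuousLinearMap.le_opNorm _ _).trans
        (mul_le_mul hlip hnorm (norm_nonneg _) (by positivity))
    rw [hneg, hfcstar, hL] at htan
    have hpC : p * C = K * n ^ 2 := by rw [hCdef]; field_simp
    have hsum : p * ((β - cstar) + (n - 1) * (γ - cstar)) = K * (n * v) * (n * v) := by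
      rw [hβ, ← hv]
      linear_combination v ^ 2 * hpC
    have hf1 : 1 ≤ f (vec n β γ) := by
      have := (abs_le.1 herr).1
      linarith
    have := hgup γ (hγ₀cstar.trans_le hγ) β hin.2 hf1
    linarith
  obtain ⟨-, -, hwγ, hwd⟩ := hw
  obtain ⟨B, R, hR, hB⟩ := exists_abs_mul_pow_le (v := fun r => w r - cstar)
    (k := fun r => g (w r) - w r) hn0 hC hδ (fun r hr => (hwd r hr).sub_const cstar)
    (fun r hr => hglow _ (hwγ r hr)) (fun r _ h => hgdecay _ (sub_nonneg.1 h))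
    (fun r _ h h' => hquad _ (sub_nonneg.1 h) h')
  have hO : (fun r : ℝ => w r - cstar) =O[atTop] (fun r : ℝ => r ^ (-(n : ℝ))) := by
    refine IsBigO.of_bound B ?_
    filter_upwards [eventually_ge_atTop R] with r hr
    have hr0 : 0 < r := by linarith
    rw [Real.rpow_neg hr0.le, Real.rpow_natCast, Real.norm_of_nonneg (r := (r ^ n)⁻¹) (by positivity),
      ← div_eq_mul_inv, le_div_iff₀ (by positivity)]
    exact hB r hr
  exact ⟨hO, integral_expansion_of_isBigO hn b (fun r hr => (hwd r hr).continuousWithinAt) hO⟩
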